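/- Exactly 13 of the 34 isomorphism classes of simple graphs on 5 vertices are universally solvable; that is, the set of isomorphism classes of simple graphs on a 5-element vertex set whose members are universally solvable has cardinality 13. -/

import Mathlib

open scoped Classical in
/-- The neighborhood matrix of a simple graph `G` over the field `ℤ/2ℤ`:
its `(u, v)` entry is `1` if `u = v` or `u` is adjacent to `v`, and `0` otherwise. -/
noncomputable def neighborhoodMatrix {V : Type*} [Fintype V]
    (G : SimpleGraph V) : Matrix V V (ZMod 2) :=
  fun u v => if u = v ∨ G.Adj u v then 1 else 0

/-- Lights Out on `G` is universally solvable: every configuration `b` can be obtained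
by pressing some set of vertices `x`. -/
def UniversallySolvable {V : Type*} [Fintype V] (G : SimpleGraph V) : Prop :=
  ∀ b : V → ZMod 2, ∃ x : V → ZMod 2, (neighborhoodMatrix G).mulVec x = b

/-- The setoid on labeled simple graphs with vertex set `V` whose equivalence classes are
the isomorphism classes of simple graphs. -/
def graphIsoSetoid (V : Type*) : Setoid (SimpleGraph V) where
  r G H := Nonempty (G ≃g H)
  iseqv := ⟨fun G => ⟨SimpleGraph.Iso.refl⟩,
    fun ⟨e⟩ => ⟨e.symm⟩, fun ⟨e⟩ ⟨f⟩ => ⟨e.trans f⟩⟩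

theorem neighborhoodMatrix_mulVec_apply {V : Type*} [Fintype V] [DecidableEq V]
    (G : SimpleGraph V) [DecidableRel G.Adj] (x : V → ZMod 2) (u : V) :
    (neighborhoodMatrix G).mulVec x u = ∑ v, if u = v ∨ G.Adj u v then x v else 0 := by
  simp only [Matrix.mulVec, dotProduct, neighborhoodMatrix]
  refine Finset.sum_congr rfl fun v _ => ?_
  by_cases h : u = v ∨ G.Adj u v <;> simp [h]

/-- Universal solvability holds iff only the empty set of presses leaves every light unchanged. -/
theorem universallySolvable_iff {V : Type*} [Fintype V] [DecidableEq V]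
    (G : SimpleGraph V) [DecidableRel G.Adj] :
    UniversallySolvable G ↔ ∀ x : V → ZMod 2,
      (∀ u, ∑ v, (if u = v ∨ G.Adj u v then x v else 0) = 0) → x = 0 := by
  change Function.Surjective (neighborhoodMatrix G).mulVec ↔ _
  rw [← Finite.injective_iff_surjective]
  change Function.Injective (neighborhoodMatrix G).mulVecLin ↔ _
  rw [injective_iff_map_eq_zero]
  simp only [funext_iff, Matrix.mulVecLin_apply, neighborhoodMatrix_mulVec_apply, Pi.zero_apply]

theorem UniversallySolvable.of_iso {V W : Type*} [Fintype V] [Fintype W]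
    {G : SimpleGraph V} {H : SimpleGraph W} (e : G ≃g H) (hG : UniversallySolvable G) :
    UniversallySolvable H := by
  intro b
  obtain ⟨x, hx⟩ := hG (b ∘ e)
  refine ⟨x ∘ e.symm, funext fun w => ?_⟩
  have hw := congrFun hx (e.symm w)
  simp only [Function.comp_apply, RelIso.apply_symm_apply] at hw
  rw [← hw]
  refine (Fintype.sum_equiv e.toEquiv _ _ fun v => ?_).symm
  have h₁ : e.symm w = v ↔ w = e v := e.toEquiv.symm_apply_eq
  have h₂ : G.Adj (e.symm w) v ↔ H.Adj w (e v) := by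
    rw [← e.map_adj_iff, RelIso.apply_symm_apply]
  have h : e.symm w = v ∨ G.Adj (e.symm w) v ↔ w = e v ∨ H.Adj w (e v) := or_congr h₁ h₂
  have hentry : neighborhoodMatrix G (e.symm w) v = neighborhoodMatrix H w (e v) := by
    by_cases h' : w = e v ∨ H.Adj w (e v)
    · exact (if_pos (h.mpr h')).trans (if_pos h').symm
    · exact (if_neg (mt h.mp h')).trans (if_neg h').symm
  have hx : (x ∘ e.symm) (e v) = x v := congrArg x (e.symm_apply_apply v)
  exact congrArg₂ _ hentry hx.symm

/-- The multiset, over the vertices `v`, of the sum of the squared degrees of the neighbors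
of `v`. -/
def neighborDegreeSqSums {V : Type*} [Fintype V] (G : SimpleGraph V) [DecidableRel G.Adj] :
    Multiset ℕ :=
  Finset.univ.val.map fun v => ∑ w, if G.Adj v w then G.degree w ^ 2 else 0

theorem neighborDegreeSqSums_eq_of_iso {V W : Type*} [Fintype V] [Fintype W]
    {G : SimpleGraph V} {H : SimpleGraph W} [DecidableRel G.Adj] [DecidableRel H.Adj]
    (e : G ≃g H) : neighborDegreeSqSums G = neighborDegreeSqSums H := by
  unfold neighborDegreeSqSums
  rw [← congrArg Finset.val (Finset.map_univ_equiv e.toEquiv), Finset.map_val, Multiset.map_map]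
  refine Multiset.map_congr rfl fun v _ => Fintype.sum_equiv e.toEquiv _ _ fun w => ?_
  have h₁ : H.Adj (e v) (e w) ↔ G.Adj v w := e.map_adj_iff
  have h₂ : H.degree (e w) = G.degree w := e.degree_eq w
  simp [h₁, h₂]

/-- The position of the unordered pair `{u, v}` in the colexicographic order on pairs. -/
def pairIndex (u v : Fin 5) : ℕ :=
  (max u v).val * ((max u v).val - 1) / 2 + (min u v).val

/-- The graph on five vertices whose edges are the positions of the nonzero bits of `c`. -/
def graphOfCode (c : ℕ) : SimpleGraph (Fin 5) where
  Adj u v := u ≠ v ∧ c.testBit (pairIndex u v) = true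
  symm := ⟨fun u v h => ⟨h.1.symm, by simpa only [pairIndex, max_comm, min_comm] using h.2⟩⟩
  loopless := ⟨fun _ h => h.1 rfl⟩

instance (c : ℕ) : DecidableRel (graphOfCode c).Adj :=
  fun u v => inferInstanceAs (Decidable (u ≠ v ∧ c.testBit (pairIndex u v) = true))

/-- The number whose nonzero bits are the positions of the edges of `G`. -/
def graphCode (G : SimpleGraph (Fin 5)) [DecidableRel G.Adj] : ℕ :=
  Nat.ofBits fun k : Fin 10 =>
    decide (G.Adj (![0, 0, 1, 0, 1, 2, 0, 1, 2, 3] k) (![1, 2, 2, 3, 3, 3, 4, 4, 4, 4] k))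

theorem graphCode_lt (G : SimpleGraph (Fin 5)) [DecidableRel G.Adj] : graphCode G < 1024 :=
  Nat.ofBits_lt_two_pow _

theorem graphOfCode_graphCode (G : SimpleGraph (Fin 5)) [DecidableRel G.Adj] :
    graphOfCode (graphCode G) = G := by
  have key : ∀ u v : Fin 5, u < v → ((graphOfCode (graphCode G)).Adj u v ↔ G.Adj u v) := by
    intro u v huv
    have hlt : pairIndex u v < 10 := by revert u v; decide
    have h : u = (![0, 0, 1, 0, 1, 2, 0, 1, 2, 3] : Fin 10 → Fin 5) ⟨pairIndex u v, hlt⟩ ∧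
        v = (![1, 2, 2, 3, 3, 3, 4, 4, 4, 4] : Fin 10 → Fin 5) ⟨pairIndex u v, hlt⟩ := by
      revert u v; decide
    simp only [graphOfCode, graphCode, Nat.testBit_ofBits_lt _ _ hlt, ← h.1, ← h.2,
      decide_eq_true_eq, huv.ne, ne_eq, not_false_eq_true, true_and]
  ext u v
  rcases lt_trichotomy u v with h | rfl | h
  · exact key u v h
  · simp
  · rw [SimpleGraph.adj_comm, key v u h, SimpleGraph.adj_comm]

/-- The codes of one graph in each universally solvable isomorphism class. -/
def solvableCode : Fin 13 → ℕ :=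
  ![0, 3, 13, 30, 75, 77, 87, 95, 222, 236, 237, 239, 507]

theorem universallySolvable_graphOfCode_solvableCode (i : Fin 13) :
    UniversallySolvable (graphOfCode (solvableCode i)) := by
  rw [universallySolvable_iff]
  revert i
  decide +kernel

theorem neighborDegreeSqSums_solvableCode_injective :
    Function.Injective fun i => neighborDegreeSqSums (graphOfCode (solvableCode i)) := by
  decide +kernel

/-- A code which cannot be lowered by permuting vertices either is one of the solvable codes or
belongs to a graph with a nonempty set of presses leaving every light unchanged. -/
theorem solvableCode_or_permute_or_kernel : ∀ c < 1024,
    (∃ i, solvableCode i = c) ∨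
    (∃ i j, j < i ∧ graphCode ((graphOfCode c).comap (Equiv.swap i j)) < c) ∨
    (∃ x : Fin 5 → ZMod 2,
      (∀ u, ∑ v, (if u = v ∨ (graphOfCode c).Adj u v then x v else 0) = 0) ∧ x ≠ 0) ∨
    (∃ i j k l,
      graphCode ((graphOfCode c).comap (Equiv.swap i j * Equiv.swap k l : Equiv.Perm (Fin 5)))
        < c) := by
  decide +kernel

theorem exists_iso_solvableCode (G : SimpleGraph (Fin 5)) (hG : UniversallySolvable G) :
    ∃ i, Nonempty (graphOfCode (solvableCode i) ≃g G) := by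
  classical
  have hex : ∃ c, Nonempty (graphOfCode c ≃g G) :=
    ⟨graphCode G, by rw [graphOfCode_graphCode]; exact ⟨SimpleGraph.Iso.refl⟩⟩
  obtain ⟨e⟩ := Nat.find_spec hex
  have hmin : ∀ (c : ℕ), Nonempty (graphOfCode c ≃g G) → Nat.find hex ≤ c :=
    fun c hc => Nat.find_min' hex hc
  generalize Nat.find hex = c at e hmin
  have hc : c < 1024 := by
    refine (hmin (graphCode G) ?_).trans_lt (graphCode_lt G)
    rw [graphOfCode_graphCode]
    exact ⟨SimpleGraph.Iso.refl⟩
  have hpermute : ∀ σ : Equiv.Perm (Fin 5), c ≤ graphCode ((graphOfCode c).comap σ) := by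
    refine fun σ => hmin _ ?_
    rw [graphOfCode_graphCode]
    exact ⟨(SimpleGraph.Iso.comap σ (graphOfCode c)).trans e⟩
  rcases solvableCode_or_permute_or_kernel c hc with
    ⟨i, rfl⟩ | ⟨i, j, -, h⟩ | ⟨x, hx, hne⟩ | ⟨i, j, k, l, h⟩
  · exact ⟨i, ⟨e⟩⟩
  · exact absurd (hpermute (Equiv.swap i j)) (not_le.mpr (by convert h))
  · exact absurd ((universallySolvable_iff _).mp (hG.of_iso e.symm) x hx) hne
  · exact absurd (hpermute (Equiv.swap i j * Equiv.swap k l)) (not_le.mpr (by convert h))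

/-- Exactly 13 of the 34 isomorphism classes of simple graphs on 5 vertices are
universally solvable. -/
theorem card_universallySolvable_classes_five :
    Nat.card {q : Quotient (graphIsoSetoid (Fin 5)) //
      ∀ G : SimpleGraph (Fin 5), Quotient.mk (graphIsoSetoid (Fin 5)) G = q →
        UniversallySolvable G} = 13 := by
  let f : Fin 13 → {q : Quotient (graphIsoSetoid (Fin 5)) //
      ∀ G : SimpleGraph (Fin 5), Quotient.mk (graphIsoSetoid (Fin 5)) G = q →
        UniversallySolvable G} := fun i =>
    ⟨Quotient.mk _ (graphOfCode (solvableCode i)), fun _ h =>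
      (Quotient.exact h).elim fun e =>
        (universallySolvable_graphOfCode_solvableCode i).of_iso e.symm⟩
  have hf : Function.Bijective f := by
    refine ⟨fun i j hij => ?_, fun ⟨q, hq⟩ => ?_⟩
    · obtain ⟨e⟩ := Quotient.exact (congrArg Subtype.val hij)
      exact neighborDegreeSqSums_solvableCode_injective (neighborDegreeSqSums_eq_of_iso e)
    · obtain ⟨G, rfl⟩ := Quotient.exists_rep q
      obtain ⟨i, e⟩ := exists_iso_solvableCode G (hq G rfl)
      exact ⟨i, Subtype.ext (Quotient.sound e)⟩
  rw [← Nat.card_eq_of_bijective f hf, Nat.card_eq_fintype_card, Fintype.card_fin]
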